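/- Assume e ≥ 3 and n ≥ 2, and let T = {τ'_2, τ_2, τ_3, …, τ_{n+1}} be the BMR generating set. There is no finite set R' of pairs of positive words over T satisfying both: (i) the identity map on T induces an isomorphism between the group presented by ⟨T | R'⟩ and the BMR-presented braid group B(e,e,n+1); and (ii) the natural homomorphism from the monoid presented by ⟨T | R'⟩ to the group presented by ⟨T | R'⟩ is injective. -/

import Mathlib

namespace BMR

/-- The BMR generating set: `t1 = τ'_2`, `t2 = τ_2`, and `s i = τ_{i+3}` for `i < n-1`. -/
inductive Gen (n : ℕ) : Type
  | t1 : Gen n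
  | t2 : Gen n
  | s : Fin (n - 1) → Gen n

/-- `alt a b k` is the alternating product `a b a b ⋯` with `k` factors. -/
def alt {M : Type*} [Monoid M] : M → M → ℕ → M
  | _, _, 0 => 1
  | a, b, k + 1 => a * alt b a k

open FreeMonoid in
/-- The BMR relations for the braid group `B(e,e,n+1)`. -/
inductive Rel (e n : ℕ) : FreeMonoid (Gen n) → FreeMonoid (Gen n) → Prop
  | comm_ss (i j : Fin (n - 1)) (h : (i : ℕ) + 2 ≤ (j : ℕ)) :
      Rel e n (of (Gen.s i) * of (Gen.s j)) (of (Gen.s j) * of (Gen.s i))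
  | comm_t1s (j : Fin (n - 1)) (h : 1 ≤ (j : ℕ)) :
      Rel e n (of Gen.t1 * of (Gen.s j)) (of (Gen.s j) * of Gen.t1)
  | alt_rel :
      Rel e n (alt (of Gen.t2) (of Gen.t1) e) (alt (of Gen.t1) (of Gen.t2) e)
  | braid_t2 (h : 0 < n - 1) :
      Rel e n (of Gen.t2 * of (Gen.s ⟨0, h⟩) * of Gen.t2)
        (of (Gen.s ⟨0, h⟩) * of Gen.t2 * of (Gen.s ⟨0, h⟩))
  | braid_ss (i : Fin (n - 1)) (h : (i : ℕ) + 1 < n - 1) :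
      Rel e n (of (Gen.s i) * of (Gen.s ⟨(i : ℕ) + 1, h⟩) * of (Gen.s i))
        (of (Gen.s ⟨(i : ℕ) + 1, h⟩) * of (Gen.s i) * of (Gen.s ⟨(i : ℕ) + 1, h⟩))
  | braid_t1 (h : 0 < n - 1) :
      Rel e n (of Gen.t1 * of (Gen.s ⟨0, h⟩) * of Gen.t1)
        (of (Gen.s ⟨0, h⟩) * of Gen.t1 * of (Gen.s ⟨0, h⟩))
  | long (h : 0 < n - 1) :
      Rel e n (of (Gen.s ⟨0, h⟩) * of Gen.t2 * of Gen.t1 * of (Gen.s ⟨0, h⟩) * of Gen.t2 * of Gen.t1)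
        (of Gen.t2 * of Gen.t1 * of (Gen.s ⟨0, h⟩) * of Gen.t2 * of Gen.t1 * of (Gen.s ⟨0, h⟩))

/-- The BMR monoid: the monoid presented by the BMR generators and relations. -/
abbrev Mon (e n : ℕ) : Type := (conGen (Rel e n)).Quotient

/-- The canonical projection from the free monoid onto the BMR monoid. -/
def mk (e n : ℕ) : FreeMonoid (Gen n) →* Mon e n := Con.mk' _

/-- The canonical monoid map from the free monoid on the generators to the free group. -/
def toFG (n : ℕ) : FreeMonoid (Gen n) →* FreeGroup (Gen n) :=
  FreeMonoid.lift FreeGroup.of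

/-- The group relators associated with a set of positive relations. -/
def relsOf (n : ℕ) (R : Set (FreeMonoid (Gen n) × FreeMonoid (Gen n))) :
    Set (FreeGroup (Gen n)) :=
  {x | ∃ p ∈ R, x = toFG n p.1 * (toFG n p.2)⁻¹}

/-- The group relators associated with the BMR relations. -/
def grels (e n : ℕ) : Set (FreeGroup (Gen n)) :=
  {x | ∃ u v, Rel e n u v ∧ x = toFG n u * (toFG n v)⁻¹}

/-- The BMR-presented braid group `B(e,e,n+1)`. -/
abbrev Grp (e n : ℕ) : Type := PresentedGroup (grels e n)

/-- The natural map from positive words to the BMR braid group. -/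
def mkG (e n : ℕ) : FreeMonoid (Gen n) →* Grp e n :=
  FreeMonoid.lift (fun g => (PresentedGroup.of g : Grp e n))

/-- A state records the levels of two strands, their relative twist, and two counters. -/
abbrev State (e : ℕ) : Type := ℕ × ℕ × ZMod e × ℤ × ℤ

/-- The transposition of the levels `k` and `k + 1`. -/
def level (k i : ℕ) : ℕ := if i = k then k + 1 else if i = k + 1 then k else i

/-- The twist acquired by a strand at level `i` when the levels `k` and `k + 1` are exchanged
with twist `c`. -/
def twist {e : ℕ} (k : ℕ) (c : ZMod e) (i : ℕ) : ZMod e :=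
  if i = k then c else if i = k + 1 then -c else 0

/-- One if the levels `i` and `j` are exchanged with each other, and zero otherwise. -/
def crossing (k i j : ℕ) : ℤ :=
  if i = k ∧ j = k + 1 then 1 else if i = k + 1 ∧ j = k then 1 else 0

/-- The deviation of the relative twist `d` of two strands from the twist `c` with which they
are exchanged. -/
def defect {e : ℕ} (k : ℕ) (c : ZMod e) (i j : ℕ) (d : ZMod e) : ℤ :=
  if i = k ∧ j = k + 1 then (d - c).val else if i = k + 1 ∧ j = k then (-d - c).val else 0

section exchange

variable {e : ℕ}

theorem level_level (k i : ℕ) : level k (level k i) = i := by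
  unfold level; grind

theorem twist_level (k : ℕ) (c : ZMod e) (i : ℕ) : twist k c (level k i) = -twist k c i := by
  unfold level twist; grind

theorem crossing_level (k i j : ℕ) : crossing k (level k i) (level k j) = crossing k i j := by
  unfold level crossing; grind

/-- The twisted exchange of the levels `k` and `k + 1`, acting on states. -/
def exchange (k : ℕ) (c : ZMod e) : Equiv.Perm (State e) where
  toFun p := (level k p.1, level k p.2.1, p.2.2.1 + twist k c p.2.1 - twist k c p.1,
    p.2.2.2.1 + crossing k p.1 p.2.1, p.2.2.2.2 + defect k c p.1 p.2.1 p.2.2.1)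
  invFun p := (level k p.1, level k p.2.1, p.2.2.1 + twist k c p.2.1 - twist k c p.1,
    p.2.2.2.1 - crossing k p.1 p.2.1,
    p.2.2.2.2 - defect k c (level k p.1) (level k p.2.1)
      (p.2.2.1 + twist k c p.2.1 - twist k c p.1))
  left_inv := by
    rintro ⟨i, j, d, l, y⟩
    have h : d + twist k c j - twist k c i + -twist k c j + twist k c i = d := by ring
    simp [level_level, twist_level, crossing_level, h]
  right_inv := by
    rintro ⟨i, j, d, l, y⟩
    have h : d + twist k c j - twist k c i + -twist k c j + twist k c i = d := by ring
    simp [level_level, twist_level, crossing_level, h]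

theorem exchange_apply (k : ℕ) (c : ZMod e) (i j : ℕ) (d : ZMod e) (l y : ℤ) :
    exchange k c (i, j, d, l, y) = (level k i, level k j, d + twist k c j - twist k c i,
      l + crossing k i j, y + defect k c i j d) := rfl

theorem exchange_comm {k l : ℕ} (h : k + 2 ≤ l) (c : ZMod e) :
    exchange k c * exchange l 0 = exchange l 0 * exchange k c := by
  ext ⟨i, j, d, x, y⟩ : 1
  have h1 : d + 0 - 0 = d := by simp
  have h2 : 0 - (d + 0) = -d := by simp
  obtain ⟨l, rfl⟩ := Nat.exists_eq_add_of_le h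
  rcases (by omega : k = i ∨ i = k + 1 ∨ i = k + 2 + l ∨ i = k + 2 + l + 1 ∨
    (i ≠ k ∧ i ≠ k + 1 ∧ i ≠ k + 2 + l ∧ i ≠ k + 2 + l + 1)) with
    rfl | rfl | rfl | rfl | ⟨_, _, _, _⟩ <;>
  rcases (by omega : k = j ∨ j = k + 1 ∨ j = k + 2 + l ∨ j = k + 2 + l + 1 ∨
    (j ≠ k ∧ j ≠ k + 1 ∧ j ≠ k + 2 + l ∧ j ≠ k + 2 + l + 1)) with
    rfl | rfl | rfl | rfl | ⟨_, _, _, _⟩ <;>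
  simp [exchange_apply, level, twist, crossing, defect, *] <;> grind

theorem exchange_braid (k : ℕ) (c : ZMod e) :
    exchange k c * exchange (k + 1) 0 * exchange k c =
      exchange (k + 1) 0 * exchange k c * exchange (k + 1) 0 := by
  ext ⟨i, j, d, x, y⟩ : 1
  have h1 : d + 0 - c = d - c := by ring
  have h2 : 0 - (d + c) = -d - c := by ring
  have h3 : -c + -d = -d - c := by ring
  rcases (by omega : k = i ∨ i = k + 1 ∨ i = k + 2 ∨ (i ≠ k ∧ i ≠ k + 1 ∧ i ≠ k + 2)) with
    rfl | rfl | rfl | ⟨_, _, _⟩ <;>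
  rcases (by omega : k = j ∨ j = k + 1 ∨ j = k + 2 ∨ (j ≠ k ∧ j ≠ k + 1 ∧ j ≠ k + 2)) with
    rfl | rfl | rfl | ⟨_, _, _⟩ <;>
  simp [exchange_apply, level, twist, crossing, defect, *] <;> grind

theorem val_neg_add_val_sub_one [NeZero e] (u : ZMod e) :
    ((-u).val : ℤ) + (u - 1).val = e - 1 := by
  obtain ⟨n, rfl⟩ := Nat.exists_eq_succ_of_ne_zero (NeZero.ne e)
  have h : -u = -1 - (u - 1) := by ring
  have hlt := ZMod.val_lt (u - 1)
  rw [h, ZMod.val_sub (by rw [ZMod.val_neg_one]; omega), ZMod.val_neg_one]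
  push_cast [Nat.lt_succ_iff.mp hlt]
  ring

theorem exchange_succ_mul [NeZero e] (c : ZMod e) :
    exchange 0 (c + 1) * exchange 0 c = exchange (e := e) 0 1 * exchange 0 0 := by
  ext ⟨i, j, d, l, y⟩ : 1
  have h1 := val_neg_add_val_sub_one (c - d)
  have h2 := val_neg_add_val_sub_one (0 - d)
  have h3 := val_neg_add_val_sub_one (c + d)
  have h4 := val_neg_add_val_sub_one (0 + d)
  rcases i with _ | _ | i <;> rcases j with _ | _ | j <;>
  simp [exchange_apply, level, twist, crossing, defect, -ZMod.natCast_val] <;>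
    ring_nf at * <;> grind

end exchange

section relations

variable {G : Type*} [Group G]

theorem map_alt {M N : Type*} [Monoid M] [Monoid N] (f : M →* N) (a b : M) (k : ℕ) :
    f (alt a b k) = alt (f a) (f b) k := by
  induction k generalizing a b with
  | zero => simp [alt]
  | succ k ih => simp [alt, ih]

theorem alt_comm_of_succ_mul {M : Type*} [Monoid M] {e : ℕ} [NeZero e] (T : ZMod e → M)
    (h : ∀ c, T (c + 1) * T c = T 1 * T 0) : alt (T 1) (T 0) e = alt (T 0) (T 1) e := by
  have key (k : ℕ) : alt (T 1) (T 0) (k + 1) = T (k + 1) * alt (T 1) (T 0) k := by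
    induction k with
    | zero => simp [alt]
    | succ k ih =>
      rw [ih, ← mul_assoc, Nat.cast_succ, h, mul_assoc]
      rfl
  have key' (m : ℕ) (hm : m ≠ 0) (h0 : (m : ZMod e) = 0) :
      alt (T 1) (T 0) m = alt (T 0) (T 1) m := by
    obtain ⟨k, rfl⟩ := Nat.exists_eq_succ_of_ne_zero hm
    rw [Nat.succ_eq_add_one, key, ← Nat.cast_succ, h0]
    rfl
  exact key' e (NeZero.ne e) (ZMod.natCast_self e)

theorem long_of_mul_eq {a b t s : G} (h : t * a = a * b) (ha : a * s * a = s * a * s)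
    (hb : b * s * b = s * b * s) (ht : t * s * t = s * t * s) :
    s * a * b * s * a * b = a * b * s * a * b * s :=
  calc s * a * b * s * a * b = s * (a * b) * s * a * b := by simp only [mul_assoc]
    _ = s * t * (a * s * a) * b := by rw [← h]; simp only [mul_assoc]
    _ = (s * t * s) * a * s * b := by rw [ha]; simp only [mul_assoc]
    _ = t * s * (t * a) * s * b := by rw [← ht]; simp only [mul_assoc]
    _ = t * s * a * (b * s * b) := by rw [h]; simp only [mul_assoc]
    _ = t * (s * a * s) * b * s := by rw [hb]; simp only [mul_assoc]
    _ = t * a * s * a * b * s := by rw [← ha]; simp only [mul_assoc]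
    _ = a * b * s * a * b * s := by rw [h]

theorem mul_pow_mul_eq {a b s : G} (ha : a * s * a = s * a * s) (hb : b * s * b = s * b * s)
    (h : s * a * b * s * a * b = a * b * s * a * b * s) (k : ℕ) :
    a * b ^ (k + 1) * s * a * b * s = s * a * b * s * a ^ (k + 1) * b := by
  have h1 : s * a * b * s * (b⁻¹ * a * b) = b * (s * a * b * s) := by
    have hb' : b * s * b⁻¹ = s⁻¹ * b * s := by
      rw [mul_inv_eq_iff_eq_mul, mul_assoc, mul_assoc, eq_inv_mul_iff_mul_eq, ← mul_assoc,
        ← mul_assoc, ← hb]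
    have ha' : s * a * s⁻¹ = a⁻¹ * s * a := by
      rw [mul_inv_eq_iff_eq_mul, mul_assoc, mul_assoc, eq_inv_mul_iff_mul_eq, ← mul_assoc,
        ← mul_assoc, ha]
    calc s * a * b * s * (b⁻¹ * a * b) = s * a * (b * s * b⁻¹) * a * b := by group
      _ = (s * a * s⁻¹) * b * s * a * b := by rw [hb']; group
      _ = a⁻¹ * (s * a * b * s * a * b) := by rw [ha']; group
      _ = b * (s * a * b * s) := by rw [h]; group
  have h2 (m : ℕ) : s * a * b * s * (b⁻¹ * a * b) ^ m = b ^ m * (s * a * b * s) := by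
    induction m with
    | zero => simp
    | succ m ih => rw [pow_succ, ← mul_assoc, ih, mul_assoc, h1, pow_succ, mul_assoc (b ^ m)]
  have h3 : (b⁻¹ * a * b) ^ k = b⁻¹ * a ^ k * b := by
    simpa using conj_pow (a := b⁻¹) (b := a) (i := k)
  calc a * b ^ (k + 1) * s * a * b * s = a * b * (b ^ k * (s * a * b * s)) := by
        rw [pow_succ']; simp only [mul_assoc]
    _ = (a * b * s * a * b * s) * (b⁻¹ * a * b) ^ k := by rw [← h2]; simp only [mul_assoc]
    _ = s * a * b * s * a ^ (k + 1) * b := by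
        rw [← h, h3, pow_succ']; group

end relations

section action

variable {e n : ℕ}

/-- The action of a generator on states. -/
def genAct (e n : ℕ) : Gen n → Equiv.Perm (State e)
  | .t1 => exchange 0 0
  | .t2 => exchange 0 1
  | .s j => exchange (j + 1) 0

/-- The action of positive words on states. -/
def wordAct (e n : ℕ) : FreeMonoid (Gen n) →* Equiv.Perm (State e) :=
  FreeMonoid.lift (genAct e n)

theorem wordAct_of (g : Gen n) : wordAct e n (FreeMonoid.of g) = genAct e n g := by
  simp [wordAct]

theorem wordAct_eq_of_rel [NeZero e] {u v : FreeMonoid (Gen n)} (h : Rel e n u v) :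
    wordAct e n u = wordAct e n v := by
  cases h with
  | comm_ss i j h => simpa [wordAct_of, genAct] using exchange_comm (by omega) 0
  | comm_t1s j h => simpa [wordAct_of, genAct] using exchange_comm (by omega) 0
  | alt_rel =>
    simpa [map_alt, wordAct_of, genAct] using
      alt_comm_of_succ_mul (fun c : ZMod e => exchange 0 c) exchange_succ_mul
  | braid_t2 h => simpa [wordAct_of, genAct] using exchange_braid 0 1
  | braid_ss i h => simpa [wordAct_of, genAct] using exchange_braid (i + 1) 0
  | braid_t1 h => simpa [wordAct_of, genAct] using exchange_braid 0 0
  | long h =>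
    have h2 := exchange_succ_mul (1 : ZMod e)
    simpa [wordAct_of, genAct] using
      long_of_mul_eq h2 (exchange_braid 0 1) (exchange_braid 0 0) (exchange_braid 0 _)

theorem lift_toFG {G : Type*} [Group G] (f : Gen n → G) (w : FreeMonoid (Gen n)) :
    FreeGroup.lift f (toFG n w) = FreeMonoid.lift f w := by
  have : (FreeGroup.lift f).comp (toFG n) = FreeMonoid.lift f :=
    FreeMonoid.hom_eq fun g => by simp [toFG]
  exact DFunLike.congr_fun this w

theorem lift_eq_of_rels {G : Type*} [Group G] {rels : Set (FreeGroup (Gen n))}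
    {u v : FreeMonoid (Gen n)} (h : toFG n u * (toFG n v)⁻¹ ∈ rels)
    (φ : PresentedGroup rels →* G) :
    FreeMonoid.lift (fun g => φ (.of g)) u = FreeMonoid.lift (fun g => φ (.of g)) v := by
  have key (w : FreeMonoid (Gen n)) :
      FreeMonoid.lift (fun g => φ (.of g)) w = φ (PresentedGroup.mk rels (toFG n w)) := by
    have : FreeMonoid.lift (fun g => φ (.of g)) =
        (φ.comp (PresentedGroup.mk rels)).comp (toFG n) :=
      FreeMonoid.hom_eq fun g => by simp [toFG, PresentedGroup.of]
    exact DFunLike.congr_fun this w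
  have h1 := PresentedGroup.one_of_mem h
  rw [map_mul, map_inv, mul_inv_eq_one] at h1
  rw [key, key, h1]

theorem mkG_eq_of_rel {u v : FreeMonoid (Gen n)} (h : Rel e n u v) : mkG e n u = mkG e n v :=
  lift_eq_of_rels (rels := grels e n) ⟨u, v, h, rfl⟩ (MonoidHom.id _)

theorem wordAct_eq_of_mkG_eq [NeZero e] {u v : FreeMonoid (Gen n)} (h : mkG e n u = mkG e n v) :
    wordAct e n u = wordAct e n v := by
  have hrel : ∀ r ∈ grels e n, FreeGroup.lift (genAct e n) r = 1 := by
    rintro _ ⟨u, v, huv, rfl⟩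
    rw [map_mul, map_inv, lift_toFG, lift_toFG, mul_inv_eq_one]
    exact wordAct_eq_of_rel huv
  have key : (PresentedGroup.toGroup hrel).comp (mkG e n) = wordAct e n :=
    FreeMonoid.hom_eq fun g => by simp [mkG, wordAct]
  rw [← key, MonoidHom.comp_apply, h, MonoidHom.comp_apply]

end action

section rigidity

variable {e n : ℕ}

theorem crossing_nonneg (k i j : ℕ) : 0 ≤ crossing k i j := by
  unfold crossing; grind

theorem defect_nonneg (k : ℕ) (c : ZMod e) (i j : ℕ) (d : ZMod e) : 0 ≤ defect k c i j d := by
  unfold defect; split_ifs <;> positivity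

theorem exchange_le (k : ℕ) (c : ZMod e) (S : State e) :
    S.2.2.2.1 ≤ (exchange k c S).2.2.2.1 ∧ S.2.2.2.2 ≤ (exchange k c S).2.2.2.2 :=
  ⟨le_add_of_nonneg_right (crossing_nonneg _ _ _), le_add_of_nonneg_right (defect_nonneg _ _ _ _ _)⟩

theorem wordAct_le (w : FreeMonoid (Gen n)) (S : State e) :
    S.2.2.2.1 ≤ (wordAct e n w S).2.2.2.1 ∧ S.2.2.2.2 ≤ (wordAct e n w S).2.2.2.2 := by
  induction w using FreeMonoid.inductionOn' with
  | one => simp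
  | of_mul g w ih =>
    have h : ∀ S : State e, S.2.2.2.1 ≤ (genAct e n g S).2.2.2.1 ∧
        S.2.2.2.2 ≤ (genAct e n g S).2.2.2.2 := by
      intro S
      cases g <;> exact exchange_le _ _ S
    rw [map_mul, wordAct_of, Equiv.Perm.mul_apply]
    exact ⟨ih.1.trans (h _).1, ih.2.trans (h _).2⟩

/-- The permutation `P` is not induced by a positive word ending in `g`, because one of the
counters grows less under `P` than under `g`. -/
def Excludes (P : Equiv.Perm (State e)) (g : Gen n) : Prop :=
  ∃ S, (P S).2.2.2.1 < (genAct e n g S).2.2.2.1 ∨ (P S).2.2.2.2 < (genAct e n g S).2.2.2.2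

theorem Excludes.ne {P : Equiv.Perm (State e)} {g : Gen n} (h : Excludes P g)
    (q : FreeMonoid (Gen n)) : wordAct e n (q * .of g) ≠ P := by
  rintro rfl
  obtain ⟨S, hS⟩ := h
  have := wordAct_le q (genAct e n g S)
  rw [map_mul, wordAct_of, Equiv.Perm.mul_apply] at hS
  omega

theorem eq_one_or_mul_of (q : FreeMonoid (Gen n)) : q = 1 ∨ ∃ q' g, q = q' * .of g := by
  rcases List.eq_nil_or_concat q.toList with h | ⟨l, g, h⟩
  · exact .inl (FreeMonoid.toList.injective h)
  · exact .inr ⟨.ofList l, g, FreeMonoid.toList.injective (by simpa using h)⟩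

theorem wordAct_ne {P : Equiv.Perm (State e)} (h1 : P ≠ 1) (h : ∀ g : Gen n, Excludes P g)
    (q : FreeMonoid (Gen n)) : wordAct e n q ≠ P := by
  rcases eq_one_or_mul_of q with rfl | ⟨q', g, rfl⟩
  · simpa using h1.symm
  · exact (h g).ne q'

/-- A positive word is rigid if it is determined by its action on states. -/
def Rigid (e : ℕ) (w : FreeMonoid (Gen n)) : Prop :=
  ∀ q, wordAct e n q = wordAct e n w → q = w

theorem excludes_one (g : Gen n) : Excludes (1 : Equiv.Perm (State e)) g := by
  cases g with
  | t1 => exact ⟨(0, 1, 0, 0, 0), .inl (by simp [genAct, exchange_apply, crossing])⟩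
  | t2 => exact ⟨(0, 1, 0, 0, 0), .inl (by simp [genAct, exchange_apply, crossing])⟩
  | s j => exact ⟨(j + 1, j + 2, 0, 0, 0), .inl (by simp [genAct, exchange_apply, crossing])⟩

theorem rigid_one : Rigid e (1 : FreeMonoid (Gen n)) := by
  intro q hq
  rcases eq_one_or_mul_of q with rfl | ⟨q', g, rfl⟩
  · rfl
  · exact absurd (hq.trans (map_one _)) ((excludes_one g).ne q')

theorem Rigid.mul_of {w : FreeMonoid (Gen n)} {g : Gen n} (hw : Rigid e w)
    (h : ∀ x ≠ g, ∀ q, wordAct e n (q * .of x) ≠ wordAct e n (w * .of g)) :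
    Rigid e (w * .of g) := by
  intro q hq
  rcases eq_one_or_mul_of q with rfl | ⟨q', x, rfl⟩
  · exact absurd (hq.symm.trans (map_one _)) ((excludes_one g).ne w)
  · by_cases hx : x = g
    · subst hx
      rw [map_mul, map_mul, mul_left_inj] at hq
      rw [hw q' hq]
    · exact absurd hq (h x hx q')

theorem Rigid.of_mul {l w r : FreeMonoid (Gen n)} (h : Rigid e (l * w * r)) : Rigid e w := by
  intro q hq
  have := h (l * q * r) (by simp [hq])
  rwa [mul_left_inj, mul_right_inj] at this

/-- The permutations that ignore the second strand as long as its level is at least `r`. -/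
def ignoring (e r : ℕ) : Submonoid (Equiv.Perm (State e)) where
  carrier := {P | ∀ S : State e, r ≤ S.2.1 → (P S).2.1 = S.2.1 ∧ (P S).2.2.2.1 = S.2.2.2.1}
  one_mem' := by simp
  mul_mem' {P Q} hP hQ S hS := by
    have h1 := hQ S hS
    have h2 := hP (Q S) (by rw [h1.1]; exact hS)
    rw [Equiv.Perm.mul_apply, h2.1, h2.2]
    exact h1

theorem exchange_mem_ignoring {r k : ℕ} (h : k + 2 ≤ r) (c : ZMod e) :
    exchange k c ∈ ignoring e r := by
  rintro ⟨i, j, d, l, y⟩ hS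
  simp only at hS
  simp [exchange_apply, level, crossing]
  grind

theorem excludes_s {P : Equiv.Perm (State e)} {j : Fin (n - 1)} (hP : P ∈ ignoring e (j + 2)) :
    Excludes P (.s j) := by
  refine ⟨(j + 1, j + 2, 0, 0, 0), .inl ?_⟩
  rw [(hP _ le_rfl).2]
  simp [genAct, exchange_apply, crossing]

theorem exchange_zero_pow_apply_of_two_le (c : ZMod e) (m : ℕ) (S : State e)
    (h : 2 ≤ S.1 ∨ 2 ≤ S.2.1) : ((exchange 0 c ^ m) S).2.2.2 = S.2.2.2 := by
  induction m generalizing S with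
  | zero => rfl
  | succ m ih =>
    obtain ⟨i, j, d, l, y⟩ := S
    simp only at h
    rw [pow_succ, Equiv.Perm.mul_apply, ih]
    · simp [exchange_apply, crossing, defect]
      grind
    · simp [exchange_apply, level]
      grind

theorem exchange_zero_pow_apply_aligned (c : ZMod e) (m : ℕ) (S : State e)
    (h : (S.1 = 0 ∧ S.2.1 = 1 ∧ S.2.2.1 = c) ∨ (S.1 = 1 ∧ S.2.1 = 0 ∧ S.2.2.1 = -c)) :
    ((exchange 0 c ^ m) S).2.2.2 = (S.2.2.2.1 + m, S.2.2.2.2) := by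
  induction m generalizing S with
  | zero => simp
  | succ m ih =>
    obtain ⟨i, j, d, l, y⟩ := S
    simp only at h
    rw [pow_succ, Equiv.Perm.mul_apply, ih]
    · rcases h with ⟨rfl, rfl, rfl⟩ | ⟨rfl, rfl, rfl⟩ <;>
        simp [exchange_apply, crossing, defect] <;> ring
    · rcases h with ⟨rfl, rfl, rfl⟩ | ⟨rfl, rfl, rfl⟩ <;> simp [exchange_apply, level, twist]

theorem val_pos {d : ZMod e} [NeZero e] (h : d ≠ 0) : 0 < d.val := by
  simpa [pos_iff_ne_zero] using h

end rigidity

section rigid_words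

variable {e n : ℕ}

open FreeMonoid in
theorem rigid_t1_pow [NeZero e] (h1 : (1 : ZMod e) ≠ 0) (m : ℕ) :
    Rigid e (of (Gen.t1 : Gen n) ^ m) := by
  induction m with
  | zero => exact rigid_one
  | succ m ih =>
    have hP : wordAct e n (of Gen.t1 ^ m * of Gen.t1) = exchange 0 0 ^ m * exchange 0 0 := by
      simp [wordAct_of, genAct]
    rw [pow_succ]
    refine ih.mul_of fun x hx => Excludes.ne ?_
    rw [hP]
    rcases x with _ | _ | j
    · exact absurd rfl hx
    · refine ⟨(0, 1, 0, 0, 0), .inr ?_⟩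
      rw [← pow_succ, exchange_zero_pow_apply_aligned 0 _ _ (by simp)]
      simpa [genAct, exchange_apply, defect, -ZMod.natCast_val] using val_pos (neg_ne_zero.2 h1)
    · exact excludes_s (mul_mem (pow_mem (exchange_mem_ignoring (by omega) 0) _)
        (exchange_mem_ignoring (by omega) 0))

open FreeMonoid in
theorem rigid_t1_pow_mul_s [NeZero e] (h1 : (1 : ZMod e) ≠ 0) (h : 0 < n - 1) (m : ℕ) :
    Rigid e (of (Gen.t1 : Gen n) ^ m * of (.s ⟨0, h⟩)) := by
  have hP : wordAct e n (of Gen.t1 ^ m * of (.s ⟨0, h⟩)) = exchange 0 0 ^ m * exchange 1 0 := by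
    simp [wordAct_of, genAct]
  refine (rigid_t1_pow h1 m).mul_of fun x hx => Excludes.ne ?_
  rw [hP]
  rcases x with _ | _ | ⟨_ | j, hj⟩
  · refine ⟨(0, 1, 0, 0, 0), .inl ?_⟩
    simp [genAct, exchange_apply, level, twist, crossing, exchange_zero_pow_apply_of_two_le]
  · refine ⟨(0, 1, 0, 0, 0), .inl ?_⟩
    simp [genAct, exchange_apply, level, twist, crossing, exchange_zero_pow_apply_of_two_le]
  · exact absurd rfl hx
  · exact excludes_s (mul_mem (pow_mem (exchange_mem_ignoring (by simp) 0) _)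
      (exchange_mem_ignoring (by simp) 0))

open FreeMonoid in
theorem rigid_t1_pow_mul_s_mul_t2 [NeZero e] (h1 : (1 : ZMod e) ≠ 0) (h : 0 < n - 1) (m : ℕ) :
    Rigid e (of (Gen.t1 : Gen n) ^ m * of (.s ⟨0, h⟩) * of .t2) := by
  have hP : wordAct e n (of Gen.t1 ^ m * of (.s ⟨0, h⟩) * of .t2) =
      exchange 0 0 ^ m * exchange 1 0 * exchange 0 1 := by
    simp [wordAct_of, genAct]
  refine (rigid_t1_pow_mul_s h1 h m).mul_of fun x hx => Excludes.ne ?_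
  rw [hP]
  rcases x with _ | _ | ⟨_ | j, hj⟩
  · refine ⟨(0, 1, 1, 0, 0), .inr ?_⟩
    simpa [genAct, exchange_apply, level, twist, defect, exchange_zero_pow_apply_of_two_le,
      -ZMod.natCast_val] using val_pos h1
  · exact absurd rfl hx
  · refine ⟨(1, 2, -1, 0, 0), .inr ?_⟩
    simpa [genAct, exchange_apply, level, twist, defect, exchange_zero_pow_apply_aligned,
      -ZMod.natCast_val] using val_pos (neg_ne_zero.2 h1)
  · refine excludes_s (mul_mem (mul_mem (pow_mem ?_ _) ?_) ?_) <;>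
      exact exchange_mem_ignoring (by simp) _

open FreeMonoid in
theorem rigid_t1_pow_mul_s_mul_t2_mul_t1 [NeZero e] (h1 : (1 : ZMod e) ≠ 0)
    (h2 : (2 : ZMod e) ≠ 0) (h : 0 < n - 1) (m : ℕ) :
    Rigid e (of (Gen.t1 : Gen n) ^ m * of (.s ⟨0, h⟩) * of .t2 * of .t1) := by
  have hP : wordAct e n (of Gen.t1 ^ m * of (.s ⟨0, h⟩) * of .t2 * of .t1) =
      exchange 0 0 ^ m * exchange 1 0 * exchange 0 1 * exchange 0 0 := by
    simp [wordAct_of, genAct]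
  refine (rigid_t1_pow_mul_s_mul_t2 h1 h m).mul_of fun x hx => ?_
  rw [hP]
  rcases x with _ | _ | ⟨_ | j, hj⟩
  · exact absurd rfl hx
  · intro q hq
    have hq' : wordAct e n q = exchange 0 0 ^ m * exchange 1 0 * exchange 0 2 := by
      rw [map_mul, wordAct_of, mul_assoc _ (exchange 0 1), ← exchange_succ_mul 1,
        one_add_one_eq_two, ← mul_assoc] at hq
      exact mul_right_cancel hq
    refine wordAct_ne (fun hone => ?_) (fun g => ?_) q hq'
    · have := congr_arg (fun P => (P ((0, 1, 2, 0, 0) : State e)).2.2.2.1) hone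
      simp [exchange_apply, level, twist, crossing, exchange_zero_pow_apply_of_two_le] at this
    · rcases g with _ | _ | ⟨_ | j, hj⟩
      · refine ⟨(0, 1, 2, 0, 0), .inr ?_⟩
        simpa [genAct, exchange_apply, level, twist, defect, exchange_zero_pow_apply_of_two_le,
          -ZMod.natCast_val] using val_pos h2
      · refine ⟨(0, 1, 2, 0, 0), .inr ?_⟩
        have h3 : (2 : ZMod e) - 1 = 1 := by ring
        simpa [genAct, exchange_apply, level, twist, defect, exchange_zero_pow_apply_of_two_le, h3,
          -ZMod.natCast_val] using val_pos h1
      · refine ⟨(1, 2, -2, 0, 0), .inr ?_⟩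
        simpa [genAct, exchange_apply, level, twist, defect, exchange_zero_pow_apply_aligned,
          -ZMod.natCast_val] using val_pos (neg_ne_zero.2 h2)
      · refine excludes_s (mul_mem (mul_mem (pow_mem ?_ _) ?_) ?_) <;>
          exact exchange_mem_ignoring (by simp) _
  · refine Excludes.ne ⟨(1, 2, 1, 0, 0), .inr ?_⟩
    simpa [genAct, exchange_apply, level, twist, defect, exchange_zero_pow_apply_of_two_le,
      -ZMod.natCast_val] using val_pos h1
  · refine Excludes.ne (excludes_s (mul_mem (mul_mem (mul_mem (pow_mem ?_ _) ?_) ?_) ?_)) <;>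
      exact exchange_mem_ignoring (by simp) _

open FreeMonoid in
theorem rigid_t1_pow_mul_s_mul_t2_mul_t1_mul_s [NeZero e] (h1 : (1 : ZMod e) ≠ 0)
    (h2 : (2 : ZMod e) ≠ 0) (h : 0 < n - 1) (m : ℕ) :
    Rigid e (of (Gen.t1 : Gen n) ^ m * of (.s ⟨0, h⟩) * of .t2 * of .t1 * of (.s ⟨0, h⟩)) := by
  have hP : wordAct e n (of Gen.t1 ^ m * of (.s ⟨0, h⟩) * of .t2 * of .t1 * of (.s ⟨0, h⟩)) =
      exchange 0 0 ^ m * exchange 1 0 * exchange 0 1 * exchange 0 0 * exchange 1 0 := by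
    simp [wordAct_of, genAct]
  refine (rigid_t1_pow_mul_s_mul_t2_mul_t1 h1 h2 h m).mul_of fun x hx => Excludes.ne ?_
  rw [hP]
  rcases x with _ | _ | ⟨_ | j, hj⟩
  · refine ⟨(0, 1, -1, 0, 0), .inr ?_⟩
    simpa [genAct, exchange_apply, level, twist, defect, exchange_zero_pow_apply_aligned,
      -ZMod.natCast_val] using val_pos (neg_ne_zero.2 h1)
  · refine ⟨(0, 1, -1, 0, 0), .inr ?_⟩
    have h3 : -1 - 1 = -(2 : ZMod e) := by ring
    simpa [genAct, exchange_apply, level, twist, defect, exchange_zero_pow_apply_aligned, h3,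
      -ZMod.natCast_val] using val_pos (neg_ne_zero.2 h2)
  · exact absurd rfl hx
  · refine excludes_s (mul_mem (mul_mem (mul_mem (mul_mem (pow_mem ?_ _) ?_) ?_) ?_) ?_) <;>
      exact exchange_mem_ignoring (by simp) _

open FreeMonoid in
theorem rigid_t2_mul_t1_pow [NeZero e] (h1 : (1 : ZMod e) ≠ 0) (h2 : (2 : ZMod e) ≠ 0) (m : ℕ) :
    Rigid e (of (Gen.t2 : Gen n) * of .t1 ^ m) := by
  induction m with
  | zero =>
    have hP : wordAct e n (1 * of .t2) = exchange 0 1 := by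
      simp [wordAct_of, genAct]
    suffices h : Rigid e (1 * of (.t2 : Gen n)) by simpa using h
    refine rigid_one.mul_of fun x hx => Excludes.ne ?_
    rw [hP]
    rcases x with _ | _ | j
    · refine ⟨(0, 1, 1, 0, 0), .inr ?_⟩
      simpa [genAct, exchange_apply, defect, -ZMod.natCast_val] using val_pos h1
    · exact absurd rfl hx
    · exact excludes_s (exchange_mem_ignoring (by simp) _)
  | succ m ih =>
    have hP : wordAct e n (of .t2 * of .t1 ^ m * of .t1) =
        exchange 0 1 * exchange 0 0 ^ (m + 1) := by
      simp [wordAct_of, genAct, pow_succ, mul_assoc]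
    rw [pow_succ, ← mul_assoc]
    refine ih.mul_of fun x hx => ?_
    rw [hP]
    rcases x with _ | _ | j
    · exact absurd rfl hx
    · intro q hq
      have hq' : wordAct e n q = exchange 0 2 ^ (m + 1) := by
        have hconj : SemiconjBy (exchange (e := e) 0 1) (exchange 0 0) (exchange 0 2) := by
          rw [SemiconjBy, ← exchange_succ_mul 1, one_add_one_eq_two]
        rw [map_mul, wordAct_of, (hconj.pow_right (m + 1)).eq] at hq
        exact mul_right_cancel hq
      refine wordAct_ne (fun hone => ?_) (fun g => ?_) q hq'
      · have := congr_arg (fun P => (P ((0, 1, 2, 0, 0) : State e)).2.2.2.1) hone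
        rw [exchange_zero_pow_apply_aligned _ _ _ (by simp)] at this
        simp at this
        omega
      · rcases g with _ | _ | j
        · refine ⟨(0, 1, 2, 0, 0), .inr ?_⟩
          rw [exchange_zero_pow_apply_aligned _ _ _ (by simp)]
          simpa [genAct, exchange_apply, defect, -ZMod.natCast_val] using val_pos h2
        · refine ⟨(0, 1, 2, 0, 0), .inr ?_⟩
          have h3 : (2 : ZMod e) - 1 = 1 := by ring
          rw [exchange_zero_pow_apply_aligned _ _ _ (by simp)]
          simpa [genAct, exchange_apply, defect, h3, -ZMod.natCast_val] using val_pos h1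
        · exact excludes_s (pow_mem (exchange_mem_ignoring (by simp) _) _)
    · exact (excludes_s (mul_mem (exchange_mem_ignoring (by simp) _)
        (pow_mem (exchange_mem_ignoring (by simp) _) _))).ne

end rigid_words

section presentations

variable {e n : ℕ}

theorem length_of_pow {α : Type*} (x : α) (m : ℕ) : (FreeMonoid.of x ^ m).length = m := by
  induction m with
  | zero => rfl
  | succ m ih => rw [pow_succ, FreeMonoid.length_mul, ih, FreeMonoid.length_of]

open FreeMonoid in
theorem rigid_of_mul_mul_eq [NeZero e] (h1 : (1 : ZMod e) ≠ 0) (h2 : (2 : ZMod e) ≠ 0)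
    (h : 0 < n - 1) {m : ℕ} {l p r : FreeMonoid (Gen n)} (hp : p.length ≤ m)
    (hw : l * p * r =
      of .t2 * of .t1 ^ m * of (.s ⟨0, h⟩) * of .t2 * of .t1 * of (.s ⟨0, h⟩)) :
    Rigid e p := by
  induction l using FreeMonoid.casesOn with
  | one =>
    have hpre : p.toList <+: (of (Gen.t2 : Gen n) * of Gen.t1 ^ m).toList := by
      refine List.prefix_of_prefix_length_le (l₃ := toList (p * r)) ⟨r.toList, by simp⟩ ?_ ?_
      · refine ⟨toList (of (.s ⟨0, h⟩) * of .t2 * of .t1 * of (.s ⟨0, h⟩)), ?_⟩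
        rw [one_mul] at hw
        rw [← toList_mul, hw]
        simp only [mul_assoc]
      · refine hp.trans ?_
        rw [← FreeMonoid.length, length_mul, length_of_pow]
        exact Nat.le_add_left _ _
    obtain ⟨t, ht⟩ := hpre
    have := rigid_t2_mul_t1_pow (n := n) h1 h2 m
    refine Rigid.of_mul (l := 1) (r := ofList t) ?_
    rw [one_mul, show p * ofList t = of .t2 * of .t1 ^ m from ht]
    exact this
  | of_mul g l =>
    have htail : l * p * r =
        of .t1 ^ m * of (.s ⟨0, h⟩) * of .t2 * of .t1 * of (.s ⟨0, h⟩) := by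
      simp only [mul_assoc] at hw ⊢
      exact (List.cons.inj hw).2
    exact Rigid.of_mul (htail ▸ rigid_t1_pow_mul_s_mul_t2_mul_t1_mul_s h1 h2 h m)

/-- The syntactic congruence of the singleton `{w}`. -/
def syntacticCon {M : Type*} [Monoid M] (w : M) : Con M where
  r x y := ∀ l r, l * x * r = w ↔ l * y * r = w
  iseqv := ⟨fun _ _ _ => .rfl, fun h l r => (h l r).symm, fun h h' l r => (h l r).trans (h' l r)⟩
  mul' {x x' y y'} h h' l r := by
    have h1 := h l (y * r)
    have h2 := h' (l * x') r
    simp only [mul_assoc] at h1 h2 ⊢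
    exact h1.trans h2

open FreeMonoid in
theorem not_conGen_of_length_le [NeZero e] (h1 : (1 : ZMod e) ≠ 0) (h2 : (2 : ZMod e) ≠ 0)
    (h : 0 < n - 1) {R : FreeMonoid (Gen n) → FreeMonoid (Gen n) → Prop} {m : ℕ}
    (hlen : ∀ p q, R p q → p.length ≤ m ∧ q.length ≤ m)
    (hR : ∀ p q, R p q → wordAct e n p = wordAct e n q) :
    ¬ conGen R (of .t2 * of .t1 ^ m * of (.s ⟨0, h⟩) * of .t2 * of .t1 * of (.s ⟨0, h⟩))
      (of (.s ⟨0, h⟩) * of .t2 * of .t1 * of (.s ⟨0, h⟩) * of .t2 ^ m * of .t1) := by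
  intro hcon
  have hle : conGen R ≤ syntacticCon
      (of .t2 * of .t1 ^ m * of (.s ⟨0, h⟩) * of .t2 * of .t1 * of (.s ⟨0, h⟩)) := by
    refine Con.conGen_le.2 fun p q hpq l r => ⟨fun hw => ?_, fun hw => ?_⟩
    · rwa [rigid_of_mul_mul_eq h1 h2 h (hlen p q hpq).1 hw q (hR p q hpq).symm]
    · rwa [rigid_of_mul_mul_eq h1 h2 h (hlen p q hpq).2 hw p (hR p q hpq)]
  have heq := ((hle hcon) 1 1).1 (by simp)
  simp only [one_mul, mul_one, mul_assoc] at heq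
  nomatch (List.cons.inj heq).1

open FreeMonoid in
theorem mkG_t2_mul_t1_pow_eq (h : 0 < n - 1) (k : ℕ) :
    mkG e n (of .t2 * of .t1 ^ (k + 1) * of (.s ⟨0, h⟩) * of .t2 * of .t1 * of (.s ⟨0, h⟩)) =
      mkG e n (of (.s ⟨0, h⟩) * of .t2 * of .t1 * of (.s ⟨0, h⟩) * of .t2 ^ (k + 1) * of .t1) := by
  have hb2 := mkG_eq_of_rel (Rel.braid_t2 (e := e) h)
  have hb1 := mkG_eq_of_rel (Rel.braid_t1 (e := e) h)
  have hl := mkG_eq_of_rel (Rel.long (e := e) h)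
  simp only [map_mul, map_pow] at hb2 hb1 hl ⊢
  exact mul_pow_mul_eq hb2 hb1 hl k

end presentations

/-- There is no finite set of positive relations on the BMR generating set which
presents the braid group `B(e,e,n+1)` (via the identity on the generators) and
whose associated presented monoid embeds in the presented group. -/
theorem no_finite_nice_presentation (e n : ℕ) (he : 3 ≤ e) (hn : 2 ≤ n) :
    ¬ ∃ R' : Finset (FreeMonoid (Gen n) × FreeMonoid (Gen n)),
      (∃ φ : PresentedGroup (relsOf n ↑R') ≃* Grp e n,
        ∀ g : Gen n, φ (PresentedGroup.of g) = PresentedGroup.of g) ∧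
      (∃ f : (conGen fun u v => (u, v) ∈ R').Quotient →*
          PresentedGroup (relsOf n ↑R'),
        (∀ g : Gen n,
          f (Con.mk' (conGen fun u v => (u, v) ∈ R') (FreeMonoid.of g)) =
            PresentedGroup.of g) ∧
        Function.Injective f) := by
  rintro ⟨R', ⟨φ, hφ⟩, f, hf, hinj⟩
  have : NeZero e := ⟨by omega⟩
  have h1 : (1 : ZMod e) ≠ 0 := fun h => by
    have := Nat.le_of_dvd one_pos ((ZMod.natCast_eq_zero_iff 1 e).1 (by simpa using h))
    omega
  have h2 : (2 : ZMod e) ≠ 0 := fun h => by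
    have := Nat.le_of_dvd two_pos ((ZMod.natCast_eq_zero_iff 2 e).1 (by simpa using h))
    omega
  have h : 0 < n - 1 := by omega
  obtain ⟨N, hN⟩ : ∃ N, ∀ r ∈ R', r.1.length ≤ N ∧ r.2.length ≤ N :=
    ⟨R'.sup fun r => max r.1.length r.2.length, fun r hr => max_le_iff.1
      (Finset.le_sup (f := fun r => max r.1.length r.2.length) hr)⟩
  have hR {p q : FreeMonoid (Gen n)} (hpq : (p, q) ∈ R') : mkG e n p = mkG e n q := by
    have := lift_eq_of_rels (rels := relsOf n ↑R') ⟨(p, q), hpq, rfl⟩ φ.toMonoidHom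
    simpa [mkG, hφ] using this
  have hφf : (φ.toMonoidHom.comp f).comp (Con.mk' _) = mkG e n :=
    FreeMonoid.hom_eq fun g => by
      simp only [MonoidHom.comp_apply, hf]
      simp [mkG, hφ]
  refine not_conGen_of_length_le (e := e) h1 h2 h (m := N + 1)
    (fun p q hpq => ⟨(hN _ hpq).1.trans N.le_succ, (hN _ hpq).2.trans N.le_succ⟩)
    (fun p q hpq => wordAct_eq_of_mkG_eq (hR hpq)) ((Con.eq _).1 (hinj (φ.injective ?_)))
  have := mkG_t2_mul_t1_pow_eq (e := e) h N
  rw [← hφf] at this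
  exact this

end BMR
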